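/- arXiv:2605.14217 — 2 statements merged into one kernel-verified Lean document; each statement's English description precedes it below -/
import Mathlib

section
/- Let r and d be positive integers with r ≤ d, let B be a real r×d matrix whose rows are orthonormal (i.e. B Bᵀ = I_r), let h ∈ ℝ^d have every coordinate nonzero, let z ∈ ℝ^r have every coordinate nonzero, and let η > 0 and s_r > 0 be real constants. Define a ∈ ℝ^r coordinatewise by a_i = −η · s_r · z_i · ( (Σ_{j=1}^d h_j² / (s_r · |z_i · h_j|)) + 1 / (s_r · |z_i|) ), and define δ = s_r · Bᵀ a ∈ ℝ^d. Then the Euclidean norm of δ satisfies ‖δ‖₂ = s_r · η · (‖h‖₁ + 1) · √r, where ‖h‖₁ = Σ_j |h_j|. -/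
open Matrix in
/-- The transpose of a matrix with orthonormal rows preserves the dot product of a vector
with itself. -/
theorem Matrix.dotProduct_transpose_mulVec_self {m n R : Type*} [Fintype m] [Fintype n]
    [DecidableEq m] [CommRing R] {B : Matrix m n R} (hB : B * Bᵀ = 1) (a : m → R) :
    (Bᵀ *ᵥ a) ⬝ᵥ (Bᵀ *ᵥ a) = a ⬝ᵥ a := by
  rw [Matrix.dotProduct_mulVec, Matrix.vecMul_transpose, Matrix.mulVec_mulVec, hB,
    Matrix.one_mulVec]

/-- Theorem C.1 main computation: the ℓ2-norm of the first-step DiReFT delta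
`δ = s_r • Bᵀ a` after one Adam step with negligible ε (SignSGD regime),
where `B` has orthonormal rows. -/
theorem direft_first_step_delta_norm
    (r d : ℕ) (hr : 0 < r) (hd : 0 < d) (hrd : r ≤ d)
    (B : Matrix (Fin r) (Fin d) ℝ) (hB : B * B.transpose = 1)
    (h : Fin d → ℝ) (hh : ∀ j, h j ≠ 0)
    (z : Fin r → ℝ) (hz : ∀ i, z i ≠ 0)
    (η s : ℝ) (hη : 0 < η) (hs : 0 < s)
    (a : Fin r → ℝ)
    (ha : ∀ i, a i = -η * s * z i *
      ((∑ j, (h j) ^ 2 / (s * |z i * h j|)) + 1 / (s * |z i|)))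
    (δ : EuclideanSpace ℝ (Fin d))
    (hδ : ∀ j, δ j = s * B.transpose.mulVec a j) :
    ‖δ‖ = s * η * ((∑ j, |h j|) + 1) * Real.sqrt r := by
  have sq_a (i : Fin r) : a i * a i = (η * ((∑ j, |h j|) + 1)) ^ 2 := by
    have hz' : |z i| ≠ 0 := abs_ne_zero.mpr (hz i)
    have hterm (j : Fin d) : (h j) ^ 2 / (s * |z i * h j|) = |h j| * (1 / (s * |z i|)) := by
      have hh' : |h j| ≠ 0 := abs_ne_zero.mpr (hh j)
      rw [abs_mul, ← sq_abs (h j)]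
      field_simp
    have hai : a i = -η * (z i / |z i|) * ((∑ j, |h j|) + 1) := by
      rw [ha, Finset.sum_congr rfl fun j _ => hterm j, ← Finset.sum_mul]
      field_simp
    have hsign : (z i / |z i|) ^ 2 = 1 := by
      rw [div_pow, sq_abs, div_self (pow_ne_zero 2 (hz i))]
    rw [hai]
    linear_combination (η * ((∑ j, |h j|) + 1)) ^ 2 * hsign
  have hsum : ∑ j, B.transpose.mulVec a j * B.transpose.mulVec a j
      = r * (η * ((∑ j, |h j|) + 1)) ^ 2 := by
    have := Matrix.dotProduct_transpose_mulVec_self hB a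
    simpa [dotProduct, sq_a] using this
  have hS : 0 ≤ ∑ j, |h j| := Finset.sum_nonneg fun j _ => abs_nonneg (h j)
  rw [← sq_eq_sq₀ (norm_nonneg δ) (by positivity), EuclideanSpace.real_norm_sq_eq, mul_pow,
    Real.sq_sqrt (Nat.cast_nonneg r)]
  simp only [hδ, mul_pow, ← Finset.mul_sum]
  simp only [sq (B.transpose.mulVec a _), hsum]
  ring
end

section
/- Let r and d be positive integers with r ≤ d, let B be a real r×d matrix whose rows are orthonormal (B Bᵀ = I_r), let h ∈ ℝ^d have every coordinate nonzero, let z ∈ ℝ^r have every coordinate nonzero, let η > 0 and c > 0 be real constants, and set s_r = c/√r. Define a ∈ ℝ^r coordinatewise by a_i = −η · s_r · z_i · ( (Σ_{j=1}^d h_j² / (s_r · |z_i · h_j|)) + 1 / (s_r · |z_i|) ), and δ = s_r · Bᵀ a. Then ‖δ‖₂ = c · η · (‖h‖₁ + 1); in particular this value does not depend on the rank r. -/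
open Matrix in
/-- If `B` has orthonormal rows, then `Bᵀ` preserves the sum of squares. -/
theorem Matrix.sum_sq_transpose_mulVec_of_mul_transpose_eq_one
    {m n : Type*} [Fintype m] [Fintype n] [DecidableEq m]
    {B : Matrix m n ℝ} (hB : B * Bᵀ = 1) (a : m → ℝ) :
    ∑ j, (Bᵀ *ᵥ a) j ^ 2 = ∑ i, a i ^ 2 := by
  have key : (Bᵀ *ᵥ a) ⬝ᵥ (Bᵀ *ᵥ a) = a ⬝ᵥ a := by
    rw [Matrix.dotProduct_mulVec, Matrix.vecMul_transpose, Matrix.mulVec_mulVec, hB,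
      Matrix.one_mulVec]
  simpa only [dotProduct, ← sq] using key

/-- The sign update `-η * sign z`, summed against the features `h` and the bias, has squared size
`(η * (‖h‖₁ + 1)) ^ 2`. -/
theorem sq_sign_update {ι : Type*} [Fintype ι] {h : ι → ℝ} (hh : ∀ j, h j ≠ 0)
    {z s : ℝ} (hz : z ≠ 0) (hs : s ≠ 0) (η : ℝ) :
    (-η * s * z * ((∑ j, h j ^ 2 / (s * |z * h j|)) + 1 / (s * |z|))) ^ 2 =
      (η * ((∑ j, |h j|) + 1)) ^ 2 := by
  have hz' : |z| ≠ 0 := abs_ne_zero.mpr hz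
  have hterm : ∀ j, h j ^ 2 / (s * |z * h j|) = |h j| / (s * |z|) := fun j => by
    have hj : |h j| ≠ 0 := abs_ne_zero.mpr (hh j)
    rw [abs_mul, ← sq_abs (h j)]
    field_simp
  simp_rw [hterm]
  rw [← Finset.sum_div, ← add_div, mul_div_assoc', div_pow]
  rw [div_eq_iff (by positivity), mul_pow s, sq_abs]
  ring

/-- Theorem C.1 conclusion: with scaling prefactor `s_r = c / √r`, the ℓ2-norm of
the first-step DiReFT delta `δ = s_r • Bᵀ a` equals `c · η · (‖h‖₁ + 1)`,
independent of the rank `r`. -/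
theorem direft_rank_invariant_delta_norm
    (r d : ℕ) (hr : 0 < r) (hd : 0 < d) (hrd : r ≤ d)
    (B : Matrix (Fin r) (Fin d) ℝ) (hB : B * B.transpose = 1)
    (h : Fin d → ℝ) (hh : ∀ j, h j ≠ 0)
    (z : Fin r → ℝ) (hz : ∀ i, z i ≠ 0)
    (η c : ℝ) (hη : 0 < η) (hc : 0 < c)
    (s : ℝ) (hs : s = c / Real.sqrt r)
    (a : Fin r → ℝ)
    (ha : ∀ i, a i = -η * s * z i *
      ((∑ j, (h j) ^ 2 / (s * |z i * h j|)) + 1 / (s * |z i|)))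
    (δ : EuclideanSpace ℝ (Fin d))
    (hδ : ∀ j, δ j = s * B.transpose.mulVec a j) :
    ‖δ‖ = c * η * ((∑ j, |h j|) + 1) := by
  have hr' : (0 : ℝ) < r := Nat.cast_pos.mpr hr
  have hs0 : s ≠ 0 := hs ▸ (div_pos hc (Real.sqrt_pos.mpr hr')).ne'
  have hs2 : s ^ 2 * r = c ^ 2 := by
    rw [hs, div_pow, Real.sq_sqrt hr'.le, div_mul_cancel₀ _ hr'.ne']
  have hnonneg : 0 ≤ c * η * ((∑ j, |h j|) + 1) := by positivity
  rw [← sq_eq_sq₀ (norm_nonneg _) hnonneg, EuclideanSpace.real_norm_sq_eq]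
  simp_rw [hδ, mul_pow s]
  rw [← Finset.mul_sum, Matrix.sum_sq_transpose_mulVec_of_mul_transpose_eq_one hB]
  simp_rw [ha, sq_sign_update hh (hz _) hs0]
  rw [Finset.sum_const, Finset.card_univ, Fintype.card_fin, nsmul_eq_mul, ← mul_assoc, hs2]
  ring
end
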